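/- arXiv:1605.05201 — 3 statements merged into one kernel-verified Lean document; each statement's English description precedes it below -/
import Mathlib

section
/- Let X be a real Hilbert space, T > 0, and F : [0,T] × X → X dissipative in the sense that ⟨F(t,v) − F(t,w), v − w⟩ ≤ 0 for all v, w ∈ X, t ∈ [0,T]. Let u : [0,T] → X be differentiable with u'(t) = F(t, u(t)) for all t ∈ [0,T], and let Û : [0,T] → X be differentiable with Û(0) = u(0), such that the residual t ↦ ‖F(t, Û(t)) − Û'(t)‖ is integrable on (0,T). Then for every t ∈ [0,T], ‖u(t) − Û(t)‖ ≤ ∫_0^t ‖F(τ, Û(τ)) − Û'(τ)‖ dτ; equivalently, ‖u − Û‖_{L^∞((0,t);X)} ≤ ‖F(·,Û(·)) − Û'‖_{L¹((0,t);X)}. -/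
open RealInnerProductSpace

/-- If `⟪e t, e' t⟫ ≤ ‖e t‖ * φ t` on `(a, b)` with `φ` nonnegative and integrable, then the growth
of `‖e‖` over `[a, b]` is at most the integral of `φ`. -/
theorem norm_sub_norm_le_integral_of_inner_deriv_le
    {E : Type*} [NormedAddCommGroup E] [InnerProductSpace ℝ E] {a b : ℝ} (hab : a ≤ b)
    {e e' : ℝ → E} {φ : ℝ → ℝ} (hcont : ContinuousOn e (Set.Icc a b))
    (hderiv : ∀ t ∈ Set.Ioo a b, HasDerivAt e (e' t) t)
    (hφ : IntervalIntegrable φ MeasureTheory.volume a b)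
    (hφ0 : ∀ t ∈ Set.Ioo a b, 0 ≤ φ t)
    (hbound : ∀ t ∈ Set.Ioo a b, ⟪e t, e' t⟫ ≤ ‖e t‖ * φ t) :
    ‖e b‖ - ‖e a‖ ≤ ∫ t in a..b, φ t := by
  refine le_of_forall_pos_le_add fun ε hε => ?_
  -- The regularization `√(‖e‖² + ε²)` is differentiable even where `e` vanishes.
  have hpos (t : ℝ) : 0 < ‖e t‖ ^ 2 + ε ^ 2 := by positivity
  have key : √(‖e b‖ ^ 2 + ε ^ 2) - √(‖e a‖ ^ 2 + ε ^ 2) ≤ ∫ t in a..b, φ t := by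
    refine intervalIntegral.sub_le_integral_of_hasDeriv_right_of_le
      (g := fun t => √(‖e t‖ ^ 2 + ε ^ 2)) hab
      (((hcont.norm.pow 2).add continuousOn_const).sqrt)
      (fun t ht => (((hderiv t ht).norm_sq.add_const (ε ^ 2)).sqrt
        (hpos t).ne').hasDerivWithinAt)
      ((intervalIntegrable_iff_integrableOn_Icc_of_le hab).1 hφ) fun t ht => ?_
    have hle : ‖e t‖ ≤ √(‖e t‖ ^ 2 + ε ^ 2) := Real.le_sqrt_of_sq_le (by nlinarith)
    rw [div_le_iff₀ (mul_pos two_pos (Real.sqrt_pos.2 (hpos t)))]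
    nlinarith [hbound t ht, mul_le_mul_of_nonneg_right hle (hφ0 t ht)]
  have hb : ‖e b‖ ≤ √(‖e b‖ ^ 2 + ε ^ 2) := Real.le_sqrt_of_sq_le (by nlinarith)
  have ha : √(‖e a‖ ^ 2 + ε ^ 2) ≤ ‖e a‖ + ε :=
    Real.sqrt_le_iff.2 ⟨by positivity, by nlinarith [norm_nonneg (e a)]⟩
  linarith

/-- Let `X` be a real Hilbert space, `T > 0`, and `F : [0,T] × X → X`
dissipative: `⟪F t v - F t w, v - w⟫ ≤ 0` for all `v, w ∈ X`, `t ∈ [0,T]`.  Let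
`u : [0,T] → X` be differentiable with `u' t = F t (u t)` on `[0,T]`, and let
`Û : [0,T] → X` be differentiable with `Û 0 = u 0` and residual
`t ↦ ‖F t (Û t) - Û' t‖` integrable on `(0,T)`.  Then for every `t ∈ [0,T]`,
`‖u t - Û t‖ ≤ ∫_0^t ‖F τ (Û τ) - Û' τ‖ dτ`. -/
theorem reconstruction_error_bound
    {X : Type*} [NormedAddCommGroup X] [InnerProductSpace ℝ X] [CompleteSpace X]
    (T : ℝ) (hT : 0 < T) (F : ℝ → X → X)
    (hdiss : ∀ t ∈ Set.Icc (0 : ℝ) T, ∀ v w : X, ⟪F t v - F t w, v - w⟫ ≤ 0)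
    (u : ℝ → X)
    (hu : ∀ t ∈ Set.Icc (0 : ℝ) T, HasDerivAt u (F t (u t)) t)
    (Uhat Uhat' : ℝ → X)
    (hUhat : ∀ t ∈ Set.Icc (0 : ℝ) T, HasDerivAt Uhat (Uhat' t) t)
    (hUhat0 : Uhat 0 = u 0)
    (hres : IntervalIntegrable (fun τ => ‖F τ (Uhat τ) - Uhat' τ‖)
      MeasureTheory.volume 0 T) :
    ∀ t ∈ Set.Icc (0 : ℝ) T,
      ‖u t - Uhat t‖ ≤ ∫ τ in (0 : ℝ)..t, ‖F τ (Uhat τ) - Uhat' τ‖ := by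
  intro t ht
  have hsub : Set.Icc 0 t ⊆ Set.Icc 0 T := Set.Icc_subset_Icc_right ht.2
  have he (s : ℝ) (hs : s ∈ Set.Icc 0 t) :
      HasDerivAt (fun s => u s - Uhat s) (F s (u s) - Uhat' s) s :=
    (hu s (hsub hs)).fun_sub (hUhat s (hsub hs))
  have h := norm_sub_norm_le_integral_of_inner_deriv_le ht.1
    (fun s hs => (he s hs).continuousAt.continuousWithinAt)
    (fun s hs => he s (Set.Ioo_subset_Icc_self hs))
    (hres.mono_set (by rwa [Set.uIcc_of_le ht.1, Set.uIcc_of_le hT.le]))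
    (fun _ _ => norm_nonneg _) fun s hs => ?_
  · simpa [hUhat0] using h
  · have hd := hdiss s (hsub (Set.Ioo_subset_Icc_self hs)) (u s) (Uhat s)
    calc ⟪u s - Uhat s, F s (u s) - Uhat' s⟫
        = ⟪F s (u s) - F s (Uhat s), u s - Uhat s⟫
          + ⟪u s - Uhat s, F s (Uhat s) - Uhat' s⟫ := by
          rw [real_inner_comm (u s - Uhat s) (F s (u s) - F s (Uhat s)),
            ← inner_add_right, sub_add_sub_cancel]
      _ ≤ ‖u s - Uhat s‖ * ‖F s (Uhat s) - Uhat' s‖ := by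
          linarith [real_inner_le_norm (u s - Uhat s) (F s (Uhat s) - Uhat' s)]
end

section
/- Let X be a real Hilbert space, T > 0, and F : [0,T] × X → X with ⟨F(t,v) − F(t,w), v − w⟩ ≤ 0 for all v, w ∈ X, t ∈ [0,T]. Let u : [0,T] → X be differentiable with u'(t) = F(t, u(t)) on [0,T], let Û : [0,T] → X be differentiable with Û(0) = u(0) and with t ↦ ‖F(t,Û(t)) − Û'(t)‖ integrable on (0,T), and let U : [0,T] → X be any continuous function. Then for every t ∈ [0,T], the a posteriori error bound sup_{0≤s≤t} ‖u(s) − U(s)‖ ≤ ∫_0^t ‖F(τ, Û(τ)) − Û'(τ)‖ dτ + sup_{0≤s≤t} ‖U(s) − Û(s)‖ holds. -/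
open RealInnerProductSpace

/-- If the component of `e'` along `e` is bounded by `φ`, then the growth of `‖e‖` is bounded by
the integral of `φ`; the norm need not be differentiable where `e` vanishes. -/
theorem norm_le_integral_of_inner_deriv_le {X : Type*} [NormedAddCommGroup X]
    [InnerProductSpace ℝ X] {e e' : ℝ → X} {φ : ℝ → ℝ} {a b : ℝ} (hab : a ≤ b)
    (he : ∀ t ∈ Set.Icc a b, HasDerivAt e (e' t) t) (hea : e a = 0)
    (hφ : MeasureTheory.IntegrableOn φ (Set.Icc a b)) (hφ0 : ∀ t ∈ Set.Icc a b, 0 ≤ φ t)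
    (hle : ∀ t ∈ Set.Icc a b, ⟪e t, e' t⟫ ≤ ‖e t‖ * φ t) :
    ‖e b‖ ≤ ∫ t in a..b, φ t := by
  refine le_of_forall_pos_le_add fun δ hδ => ?_
  have hpos : ∀ t, 0 < ‖e t‖ ^ 2 + δ ^ 2 := fun t => by positivity
  have hnorm : ∀ t, ‖e t‖ ≤ √(‖e t‖ ^ 2 + δ ^ 2) := fun t =>
    Real.le_sqrt_of_sq_le (by nlinarith [sq_nonneg δ])
  have hderiv : ∀ t ∈ Set.Icc a b, HasDerivAt (fun t => √(‖e t‖ ^ 2 + δ ^ 2))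
      (2 * ⟪e t, e' t⟫ / (2 * √(‖e t‖ ^ 2 + δ ^ 2))) t := fun t ht =>
    ((he t ht).norm_sq.add_const _).sqrt (hpos t).ne'
  have key := intervalIntegral.sub_le_integral_of_hasDeriv_right_of_le hab
    (fun t ht => (hderiv t ht).continuousAt.continuousWithinAt)
    (fun t ht => (hderiv t (Set.Ioo_subset_Icc_self ht)).hasDerivWithinAt) hφ (fun t ht => by
      have ht' := Set.Ioo_subset_Icc_self ht
      have hs := Real.sqrt_pos.2 (hpos t)
      rw [mul_div_mul_left _ _ two_ne_zero, div_le_iff₀ hs, mul_comm]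
      exact (hle t ht').trans (mul_le_mul_of_nonneg_right (hnorm t) (hφ0 t ht')))
  have hstart : √(‖e a‖ ^ 2 + δ ^ 2) = δ := by
    rw [hea, norm_zero, zero_pow two_ne_zero, zero_add, Real.sqrt_sq hδ.le]
  rw [hstart] at key
  linarith [hnorm b]

/-- Let `X` be a real Hilbert space, `T > 0`, and `F : [0,T] × X → X`
with `⟪F t v - F t w, v - w⟫ ≤ 0` for all `v, w ∈ X`, `t ∈ [0,T]`.  Let `u` be
differentiable with `u' t = F t (u t)` on `[0,T]`, let `Û` be differentiable with
`Û 0 = u 0` and integrable residual `t ↦ ‖F t (Û t) - Û' t‖`, and let `U : [0,T] → X` be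
any continuous function.  Then for every `t ∈ [0,T]` the a posteriori error bound
`sup_{0 ≤ s ≤ t} ‖u s - U s‖ ≤ ∫_0^t ‖F τ (Û τ) - Û' τ‖ dτ + sup_{0 ≤ s ≤ t} ‖U s - Û s‖`
holds. -/
theorem a_posteriori_error_bound
    {X : Type*} [NormedAddCommGroup X] [InnerProductSpace ℝ X] [CompleteSpace X]
    (T : ℝ) (hT : 0 < T) (F : ℝ → X → X)
    (hdiss : ∀ t ∈ Set.Icc (0 : ℝ) T, ∀ v w : X, ⟪F t v - F t w, v - w⟫ ≤ 0)
    (u : ℝ → X)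
    (hu : ∀ t ∈ Set.Icc (0 : ℝ) T, HasDerivAt u (F t (u t)) t)
    (Uhat Uhat' : ℝ → X)
    (hUhat : ∀ t ∈ Set.Icc (0 : ℝ) T, HasDerivAt Uhat (Uhat' t) t)
    (hUhat0 : Uhat 0 = u 0)
    (hres : IntervalIntegrable (fun τ => ‖F τ (Uhat τ) - Uhat' τ‖)
      MeasureTheory.volume 0 T)
    (U : ℝ → X) (hU : ContinuousOn U (Set.Icc (0 : ℝ) T)) :
    ∀ t ∈ Set.Icc (0 : ℝ) T,
      (⨆ s : Set.Icc (0 : ℝ) t, ‖u s - U s‖) ≤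
        (∫ τ in (0 : ℝ)..t, ‖F τ (Uhat τ) - Uhat' τ‖) +
          ⨆ s : Set.Icc (0 : ℝ) t, ‖U s - Uhat s‖ := by
  intro t ht
  have hφ : MeasureTheory.IntegrableOn (fun τ => ‖F τ (Uhat τ) - Uhat' τ‖) (Set.Icc 0 T) :=
    (intervalIntegrable_iff_integrableOn_Icc_of_le hT.le).1 hres
  have herr : ∀ s ∈ Set.Icc (0 : ℝ) t,
      ‖u s - Uhat s‖ ≤ ∫ τ in (0 : ℝ)..t, ‖F τ (Uhat τ) - Uhat' τ‖ := by
    intro s hs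
    have hsub : Set.Icc 0 s ⊆ Set.Icc 0 T := Set.Icc_subset_Icc_right (hs.2.trans ht.2)
    have hbound := norm_le_integral_of_inner_deriv_le (e := fun τ => u τ - Uhat τ)
      (e' := fun τ => F τ (u τ) - Uhat' τ) hs.1
      (fun τ hτ => (hu τ (hsub hτ)).sub (hUhat τ (hsub hτ))) (by simp [hUhat0])
      (hφ.mono_set hsub) (fun _ _ => norm_nonneg _) (fun τ hτ => by
        have hsplit : F τ (u τ) - Uhat' τ =
            (F τ (u τ) - F τ (Uhat τ)) + (F τ (Uhat τ) - Uhat' τ) := by abel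
        have hd := hdiss τ (hsub hτ) (u τ) (Uhat τ)
        rw [real_inner_comm] at hd
        rw [hsplit, inner_add_right]
        linarith [real_inner_le_norm (u τ - Uhat τ) (F τ (Uhat τ) - Uhat' τ)])
    refine hbound.trans (intervalIntegral.integral_mono_interval le_rfl hs.1 hs.2
      (Filter.Eventually.of_forall fun _ => norm_nonneg _) ?_)
    exact (intervalIntegrable_iff_integrableOn_Icc_of_le ht.1).2
      (hφ.mono_set (Set.Icc_subset_Icc_right ht.2))
  have hcont : ContinuousOn (fun s => ‖U s - Uhat s‖) (Set.Icc 0 t) :=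
    ((hU.sub fun s hs => (hUhat s hs).continuousAt.continuousWithinAt).norm).mono
      (Set.Icc_subset_Icc_right ht.2)
  have hbdd : BddAbove (Set.range fun s : Set.Icc (0 : ℝ) t => ‖U s - Uhat s‖) := by
    obtain ⟨C, hC⟩ := isCompact_Icc.bddAbove_image hcont
    exact ⟨C, by rintro _ ⟨s, rfl⟩; exact hC ⟨s, s.2, rfl⟩⟩
  have : Nonempty (Set.Icc (0 : ℝ) t) := ⟨⟨0, le_rfl, ht.1⟩⟩
  refine ciSup_le fun s => ?_
  have htri := norm_sub_le_norm_sub_add_norm_sub (u s) (Uhat s) (U s)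
  rw [norm_sub_rev (Uhat s) (U s)] at htri
  exact htri.trans (add_le_add (herr s s.2) (le_ciSup hbdd s))
end

section
/- Let X be a real Hilbert space and F : [0,T] × X → X satisfy the orthogonality property ⟨F(t,v), v⟩ = 0 for all v ∈ X, t ∈ [0,T], and the lower adjoint property ⟨F(t,v), w⟩ ≥ −⟨v, F(t,w)⟩ for all v, w ∈ X, t ∈ [0,T]. Let u : [0,T] → X be differentiable with u'(t) = F(t, u(t)) for all t, let Û : [0,T] → X be differentiable, and set ê(t) = u(t) − Û(t). Then for every t ∈ [0,T], the derivative of t ↦ ‖ê(t)‖² satisfies (d/dt)‖ê(t)‖² ≤ 2 ⟨F(t, Û(t)) − Û'(t), ê(t)⟩ ≤ 2 ‖F(t, Û(t)) − Û'(t)‖ ‖ê(t)‖. -/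
open RealInnerProductSpace

/-- An operator with the orthogonality and lower adjoint properties is dissipative. -/
theorem inner_sub_sub_nonpos_of_orthogonal_of_lower_adjoint
    {X : Type*} [NormedAddCommGroup X] [InnerProductSpace ℝ X] {G : X → X}
    (orthogonal : ∀ v, ⟪G v, v⟫ = 0) (lower_adjoint : ∀ v w, ⟪G v, w⟫ ≥ -⟪v, G w⟫) (v w : X) :
    ⟪G v - G w, v - w⟫ ≤ 0 := by
  have h := lower_adjoint v w
  simp only [inner_sub_left, inner_sub_right, orthogonal]
  linarith [real_inner_comm v (G w)]

/-- Let `X` be a real Hilbert space and `F : [0,T] × X → X` satisfy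
the orthogonality property `⟪F t v, v⟫ = 0` and the lower adjoint property
`⟪F t v, w⟫ ≥ -⟪v, F t w⟫` (for all `v, w ∈ X`, `t ∈ [0,T]`).  Let `u` be differentiable
with `u' t = F t (u t)` on `[0,T]`, let `Û` be differentiable, and set
`ê t = u t - Û t`.  Then for every `t ∈ [0,T]` the derivative of `t ↦ ‖ê t‖²` satisfies
`(d/dt)‖ê t‖² ≤ 2 ⟪F t (Û t) - Û' t, ê t⟫ ≤ 2 ‖F t (Û t) - Û' t‖ ‖ê t‖`. -/
theorem deriv_sq_norm_reconstruction_error_le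
    {X : Type*} [NormedAddCommGroup X] [InnerProductSpace ℝ X] [CompleteSpace X]
    (T : ℝ) (hT : 0 < T) (F : ℝ → X → X)
    (hF1 : ∀ t ∈ Set.Icc (0 : ℝ) T, ∀ v : X, ⟪F t v, v⟫ = 0)
    (hF3 : ∀ t ∈ Set.Icc (0 : ℝ) T, ∀ v w : X, ⟪F t v, w⟫ ≥ -⟪v, F t w⟫)
    (u : ℝ → X)
    (hu : ∀ t ∈ Set.Icc (0 : ℝ) T, HasDerivAt u (F t (u t)) t)
    (Uhat Uhat' : ℝ → X)
    (hUhat : ∀ t ∈ Set.Icc (0 : ℝ) T, HasDerivAt Uhat (Uhat' t) t) :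
    ∀ t ∈ Set.Icc (0 : ℝ) T,
      deriv (fun s => ‖u s - Uhat s‖ ^ 2) t ≤
          2 * ⟪F t (Uhat t) - Uhat' t, u t - Uhat t⟫ ∧
        2 * ⟪F t (Uhat t) - Uhat' t, u t - Uhat t⟫ ≤
          2 * (‖F t (Uhat t) - Uhat' t‖ * ‖u t - Uhat t‖) := by
  intro t ht
  constructor
  · have hd := inner_sub_sub_nonpos_of_orthogonal_of_lower_adjoint (hF1 t ht) (hF3 t ht)
      (u t) (Uhat t)
    rw [((hu t ht).fun_sub (hUhat t ht)).norm_sq.deriv, real_inner_comm]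
    have hsplit : F t (u t) - Uhat' t =
        (F t (u t) - F t (Uhat t)) + (F t (Uhat t) - Uhat' t) := by abel
    rw [hsplit, inner_add_left]
    linarith
  · gcongr
    exact real_inner_le_norm _ _
end
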